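/- Let Γ ⊂ ℤ^n be an almost periodic pattern with D(Γ) > 0. Then the mean of ρ_Γ equals D(Γ): for every ε > 0 there exists R_0 > 0 such that for every R ≥ R_0 and every x ∈ ℤ^n, |(1/Card[B(x,R)]) · Σ_{v∈[B(x,R)]} ρ_Γ(v) − D(Γ)| ≤ ε. -/

import Mathlib

open Filter MeasureTheory
open scoped BigOperators

noncomputable section

/-- The projection `p : ℝ → ℤ`: the unique `k` with `k - 1/2 < x ≤ k + 1/2`. -/
def roundHalf (x : ℝ) : ℤ := ⌈x - 1/2⌉

/-- Coercion of an integer vector to a real vector. -/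
def intVec {n : ℕ} (v : Fin n → ℤ) : Fin n → ℝ := fun i => (v i : ℝ)

/-- The set of integer points of `ℝ^n`. -/
def intPoints (n : ℕ) : Set (Fin n → ℝ) := Set.range (intVec (n := n))

/-- The coordinatewise projection `π : ℝ^n → ℤ^n`. -/
def discretize {n : ℕ} (x : Fin n → ℝ) : Fin n → ℤ := fun i => roundHalf (x i)

/-- `π` viewed as a self-map of `ℝ^n`. -/
def discretizeR {n : ℕ} (x : Fin n → ℝ) : Fin n → ℝ := intVec (discretize x)

/-- The image of a set `Γ` under the discretization `P̂` of the matrix `P`. -/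
def PhatImg {n : ℕ} (P : Matrix (Fin n) (Fin n) ℝ) (Γ : Set (Fin n → ℝ)) :
    Set (Fin n → ℝ) :=
  (fun x => discretizeR (P.mulVec x)) '' Γ

/-- The uniform `R`-density `D_R^+`. Balls are sup-norm balls. -/
def DRplus {n : ℕ} (Γ : Set (Fin n → ℝ)) (R : ℝ) : ℝ :=
  ⨆ x : Fin n → ℝ,
    ((Metric.ball x R ∩ Γ).ncard : ℝ) / ((Metric.ball x R ∩ intPoints n).ncard : ℝ)

/-- Relatively dense with parameter `R₀`. -/
def RelativelyDenseWith {n : ℕ} (Γ : Set (Fin n → ℝ)) (R₀ : ℝ) : Prop :=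
  ∀ x : Fin n → ℝ, ∀ r, R₀ ≤ r → (Metric.ball x r ∩ Γ).Nonempty

def RelativelyDense {n : ℕ} (Γ : Set (Fin n → ℝ)) : Prop :=
  ∃ R₀ > 0, RelativelyDenseWith Γ R₀

/-- Uniformly discrete with parameter `r₀`. -/
def UniformlyDiscreteWith {n : ℕ} (Γ : Set (Fin n → ℝ)) (r₀ : ℝ) : Prop :=
  ∀ x : Fin n → ℝ, ∀ r, 0 < r → r ≤ r₀ → (Metric.ball x r ∩ Γ).Subsingleton

def UniformlyDiscrete {n : ℕ} (Γ : Set (Fin n → ℝ)) : Prop :=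
  ∃ r₀ > 0, UniformlyDiscreteWith Γ r₀

def Delone {n : ℕ} (Γ : Set (Fin n → ℝ)) : Prop :=
  RelativelyDense Γ ∧ UniformlyDiscrete Γ

/-- The translateSet `Γ + v`. -/
def translateSet {n : ℕ} (Γ : Set (Fin n → ℝ)) (v : Fin n → ℝ) : Set (Fin n → ℝ) :=
  (· + v) '' Γ

/-- `N` is a set of `ε`-translations of `Γ` with radius `Rε`. -/
def IsEpsTranslationSet {n : ℕ} (Γ : Set (Fin n → ℝ)) (ε Rε : ℝ)
    (N : Set (Fin n → ℝ)) : Prop :=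
  N ⊆ intPoints n ∧ RelativelyDense N ∧
    ∀ R, Rε ≤ R → ∀ v ∈ N, DRplus (symmDiff (translateSet Γ v) Γ) R < ε

/-- Almost periodic pattern. -/
def AlmostPeriodicPattern {n : ℕ} (Γ : Set (Fin n → ℝ)) : Prop :=
  Γ ⊆ intPoints n ∧ Delone Γ ∧
    ∀ ε > 0, ∃ Rε > 0, ∃ N : Set (Fin n → ℝ), IsEpsTranslationSet Γ ε Rε N

/-- `Γ` has uniform density `D`. -/
def HasUnifDensity {n : ℕ} (Γ : Set (Fin n → ℝ)) (D : ℝ) : Prop :=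
  ∀ ε > 0, ∃ R₀ > 0, ∀ R, R₀ ≤ R → ∀ x : Fin n → ℝ,
    |((Metric.ball x R ∩ Γ).ncard : ℝ) / ((Metric.ball x R ∩ intPoints n).ncard : ℝ) - D| ≤ ε

/-- `Γ ∩ (Γ - v)`, the set of `x ∈ Γ` with `x + v ∈ Γ`. -/
def diffSet {n : ℕ} (Γ : Set (Fin n → ℝ)) (v : Fin n → ℝ) : Set (Fin n → ℝ) :=
  Γ ∩ {x | x + v ∈ Γ}

/-- `E` is equidistributed modulo `ℤ^n`: averages of continuous `ℤ^n`-periodic functions over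
`E ∩ B_R` converge to the Haar integral. -/
def EquidistributedModZn {n : ℕ} (E : Set (Fin n → ℝ)) : Prop :=
  ∀ f : (Fin n → ℝ) → ℝ, Continuous f →
    (∀ (x : Fin n → ℝ) (v : Fin n → ℤ), f (x + intVec v) = f x) →
    Filter.Tendsto (fun R : ℝ =>
        (∑ᶠ x ∈ E ∩ Metric.ball (0 : Fin n → ℝ) R, f x) /
          ((E ∩ Metric.ball (0 : Fin n → ℝ) R).ncard : ℝ))
      Filter.atTop
      (nhds (∫ x in Set.pi Set.univ (fun _ : Fin n => Set.Ico (0:ℝ) 1), f x))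

/-- `P` is totally irrational: `P(ℤ^n)` is equidistributed modulo `ℤ^n`. -/
def TotallyIrrational {n : ℕ} (P : Matrix (Fin n) (Fin n) ℝ) : Prop :=
  EquidistributedModZn (P.mulVec '' intPoints n)

/-- Rate of injectivity in time 1. -/
def tauOne {n : ℕ} (P : Matrix (Fin n) (Fin n) ℝ) : ℝ :=
  Filter.limsup (fun R : ℝ =>
    ((PhatImg P (intPoints n) ∩ Metric.ball (0 : Fin n → ℝ) R).ncard : ℝ) /
      ((intPoints n ∩ Metric.ball (0 : Fin n → ℝ) R).ncard : ℝ)) Filter.atTop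

/-- The successive images `(P̂_k ∘ ⋯ ∘ P̂_1)(Γ)`. -/
def seqImg {n : ℕ} (P : ℕ → Matrix (Fin n) (Fin n) ℝ) :
    ℕ → Set (Fin n → ℝ) → Set (Fin n → ℝ)
  | 0, Γ => Γ
  | k + 1, Γ => PhatImg (P (k + 1)) (seqImg P k Γ)

/-- Rate of injectivity in time `k` of the sequence `(P_k)`. -/
def tauK {n : ℕ} (P : ℕ → Matrix (Fin n) (Fin n) ℝ) (k : ℕ) : ℝ :=
  Filter.limsup (fun R : ℝ =>
    ((seqImg P k (intPoints n) ∩ Metric.ball (0 : Fin n → ℝ) R).ncard : ℝ) /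
      ((intPoints n ∩ Metric.ball (0 : Fin n → ℝ) R).ncard : ℝ)) Filter.atTop

/-- A fixed norm on `M_n(ℝ)`: the sup of absolute values of the entries. -/
def matNorm {n : ℕ} (A : Matrix (Fin n) (Fin n) ℝ) : ℝ :=
  ⨆ p : Fin n × Fin n, |A p.1 p.2|


/-- The function `φ_u`, a "weighted projection" of `u` on `ℤ^n`. -/
def phiFn {n : ℕ} (u : Fin n → ℝ) (v : Fin n → ℤ) : ℝ :=
  if ‖u - intVec v‖ < 1 then ∏ i, (1 - |u i - (v i : ℝ)|) else 0

/-- `I_ℚ(A)`: the set of indices `i` such that all entries of the `i`-th row of `A`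
are rational. -/
def IQ {n : ℕ} (A : Matrix (Fin n) (Fin n) ℝ) : Set (Fin n) :=
  {i | ∀ j, ∃ q : ℚ, A i j = (q : ℝ)}

/-- A sequence of matrices all lying in `O_n(ℝ)`. -/
def IsOnSeq {n : ℕ} (P : ℕ → Matrix (Fin n) (Fin n) ℝ) : Prop :=
  ∀ k, P k ∈ Matrix.orthogonalGroup (Fin n) ℝ

/-- The `ℓ^∞` distance on sequences of matrices. -/
def seqDist {n : ℕ} (P Q : ℕ → Matrix (Fin n) (Fin n) ℝ) : ℝ :=
  ⨆ k : ℕ, matNorm (P k - Q k)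

/-- Open subsets of `ℓ^∞(O_n(ℝ))`. -/
def IsOpenSeq {n : ℕ} (U : Set {P : ℕ → Matrix (Fin n) (Fin n) ℝ // IsOnSeq P}) : Prop :=
  ∀ P ∈ U, ∃ δ > 0, ∀ Q : {P : ℕ → Matrix (Fin n) (Fin n) ℝ // IsOnSeq P},
    seqDist P.1 Q.1 < δ → Q ∈ U

/-- Dense subsets of `ℓ^∞(O_n(ℝ))`. -/
def IsDenseSeq {n : ℕ} (U : Set {P : ℕ → Matrix (Fin n) (Fin n) ℝ // IsOnSeq P}) : Prop :=
  ∀ P : {P : ℕ → Matrix (Fin n) (Fin n) ℝ // IsOnSeq P}, ∀ δ > 0,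
    ∃ Q ∈ U, seqDist P.1 Q.1 < δ

theorem intVec_injective {n : ℕ} : Function.Injective (intVec (n := n)) := by
  intro v w h
  funext i
  exact Int.cast_injective (congrFun h i)

theorem intVec_add {n : ℕ} (v w : Fin n → ℤ) : intVec (v + w) = intVec v + intVec w := by
  funext i
  simp [intVec]

theorem finite_intVec_mem_ball {n : ℕ} (c : Fin n → ℝ) (R : ℝ) :
    {v : Fin n → ℤ | intVec v ∈ Metric.ball c R}.Finite := by
  refine (Set.finite_Icc (fun i => ⌊c i - R⌋) (fun i => ⌈c i + R⌉)).subset ?_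
  intro v hv
  have h : ∀ i, |(v i : ℝ) - c i| < R := fun i =>
    (norm_le_pi_norm (intVec v - c) i).trans_lt (mem_ball_iff_norm.1 hv)
  constructor <;> intro i
  · have := (abs_lt.1 (h i)).1
    exact_mod_cast (Int.floor_le (c i - R)).trans (by linarith : c i - R ≤ v i)
  · have := (abs_lt.1 (h i)).2
    exact_mod_cast (by linarith : (v i : ℝ) ≤ c i + R).trans (Int.le_ceil (c i + R))

theorem finite_ball_inter_intPoints {n : ℕ} (c : Fin n → ℝ) (R : ℝ) :
    (Metric.ball c R ∩ intPoints n).Finite := by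
  refine ((finite_intVec_mem_ball c R).image intVec).subset ?_
  rintro _ ⟨hy, v, rfl⟩
  exact ⟨v, hy, rfl⟩

/-- Translating by an integer point `y` identifies the integer vectors of a ball which are sent
into `Γ` with the points of `Γ` in the translated ball. -/
theorem ncard_ball_inter_eq {n : ℕ} {Γ : Set (Fin n → ℝ)} (hΓ : Γ ⊆ intPoints n)
    {y : Fin n → ℝ} (hy : y ∈ intPoints n) (c : Fin n → ℝ) (R : ℝ) :
    (Metric.ball (y + c) R ∩ Γ).ncard =
      {v : Fin n → ℤ | intVec v ∈ Metric.ball c R ∧ y + intVec v ∈ Γ}.ncard := by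
  obtain ⟨w, rfl⟩ := hy
  have hinj : Function.Injective fun v : Fin n → ℤ => intVec w + intVec v :=
    fun a b h => intVec_injective (add_left_cancel h)
  rw [← Set.ncard_image_of_injective _ hinj]
  congr 1
  ext z
  constructor
  · rintro ⟨hz, hzΓ⟩
    obtain ⟨u, rfl⟩ := hΓ hzΓ
    have hu : intVec w + intVec (u - w) = intVec u := by
      rw [← intVec_add, add_sub_cancel]
    refine ⟨u - w, ⟨?_, ?_⟩, hu⟩
    · rw [← hu] at hz
      simpa [Metric.mem_ball] using hz
    · rwa [hu]
  · rintro ⟨v, ⟨hv, hvΓ⟩, rfl⟩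
    exact ⟨by simpa [Metric.mem_ball] using hv, hvΓ⟩

theorem HasUnifDensity.tendsto {n : ℕ} {Γ : Set (Fin n → ℝ)} {D : ℝ}
    (h : HasUnifDensity Γ D) (x : Fin n → ℝ) :
    Tendsto (fun R : ℝ => ((Metric.ball x R ∩ Γ).ncard : ℝ) /
      ((Metric.ball x R ∩ intPoints n).ncard : ℝ)) atTop (nhds D) := by
  rw [Metric.tendsto_atTop]
  intro ε hε
  obtain ⟨R₀, -, hR₀⟩ := h (ε / 2) (half_pos hε)
  refine ⟨R₀, fun R hR => ?_⟩
  rw [Real.dist_eq]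
  exact (hR₀ R hR x).trans_lt (half_lt_self hε)

/-- Double counting: pairs of points of `Γ` with difference `v` in a finite set, the first point
lying in a ball. -/
theorem sum_ncard_diffSet {n : ℕ} {Γ : Set (Fin n → ℝ)} (S : Finset (Fin n → ℤ))
    {B : Set (Fin n → ℝ)} (F : Finset (Fin n → ℝ)) (hF : (F : Set (Fin n → ℝ)) = B ∩ Γ) :
    ∑ v ∈ S, (B ∩ diffSet Γ (intVec v)).ncard =
      ∑ y ∈ F, {v : Fin n → ℤ | v ∈ S ∧ y + intVec v ∈ Γ}.ncard := by
  classical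
  have h1 : ∀ v, (B ∩ diffSet Γ (intVec v)).ncard =
      (F.filter fun y => y + intVec v ∈ Γ).card := by
    intro v
    rw [← Set.ncard_coe_finset]
    congr 1
    ext y
    rw [Finset.coe_filter]
    simp only [← Finset.mem_coe, hF, diffSet, Set.mem_inter_iff, Set.mem_ofPred_eq, and_assoc]
  have h2 : ∀ y, {v : Fin n → ℤ | v ∈ S ∧ y + intVec v ∈ Γ}.ncard =
      (S.filter fun v => y + intVec v ∈ Γ).card := by
    intro y
    rw [← Set.ncard_coe_finset, Finset.coe_filter]
  simp only [h1, h2, Finset.card_filter]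
  exact Finset.sum_comm

/-- The mean of `ρ_Γ` equals `D(Γ)`. -/
theorem statement4 {n : ℕ} (Γ : Set (Fin n → ℝ)) (hΓ : AlmostPeriodicPattern Γ)
    (D : ℝ) (hD : HasUnifDensity Γ D) (hDpos : 0 < D)
    (ρ : (Fin n → ℤ) → ℝ)
    (hρ : ∀ v : Fin n → ℤ, HasUnifDensity (diffSet Γ (intVec v)) (ρ v * D)) :
    ∀ ε > 0, ∃ R₀ > 0, ∀ R, R₀ ≤ R → ∀ x : Fin n → ℤ,
      |(∑ᶠ v ∈ {v : Fin n → ℤ | intVec v ∈ Metric.ball (intVec x) R}, ρ v) /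
          (({v : Fin n → ℤ | intVec v ∈ Metric.ball (intVec x) R}).ncard : ℝ) - D| ≤ ε := by
  obtain ⟨hΓint, -, -⟩ := hΓ
  intro ε hε
  obtain ⟨R₀, hR₀, hunif⟩ := hD ε hε
  refine ⟨R₀, hR₀, fun R hR x => ?_⟩
  have hfin := finite_intVec_mem_ball (intVec x) R
  set S := hfin.toFinset with hS
  set N : ℝ := ({v : Fin n → ℤ | intVec v ∈ Metric.ball (intVec x) R}.ncard : ℝ)
  rw [finsum_mem_eq_finite_toFinset_sum _ hfin]
  set M : ℝ → ℝ := fun r => ((Metric.ball (0 : Fin n → ℝ) r ∩ intPoints n).ncard : ℝ)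
  have hcount : ∀ y ∈ Γ,
      |({v : Fin n → ℤ | v ∈ S ∧ y + intVec v ∈ Γ}.ncard : ℝ) / N - D| ≤ ε := by
    intro y hy
    have h := hunif R hR (y + intVec x)
    rw [ncard_ball_inter_eq hΓint (hΓint hy),
      ncard_ball_inter_eq subset_rfl (hΓint hy)] at h
    have hall : {v : Fin n → ℤ | intVec v ∈ Metric.ball (intVec x) R ∧
        y + intVec v ∈ intPoints n} = {v | intVec v ∈ Metric.ball (intVec x) R} := by
      obtain ⟨w, rfl⟩ := hΓint hy
      ext v
      simp only [Set.mem_ofPred_eq, and_iff_left_iff_imp]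
      exact fun _ => ⟨w + v, intVec_add w v⟩
    rw [hall] at h
    simpa only [hS, Set.Finite.mem_toFinset, Set.mem_ofPred_eq] using h
  have hbound : ∀ r : ℝ,
      |(∑ v ∈ S, ((Metric.ball (0 : Fin n → ℝ) r ∩ diffSet Γ (intVec v)).ncard : ℝ) / M r) / N
        - D * (((Metric.ball (0 : Fin n → ℝ) r ∩ Γ).ncard : ℝ) / M r)| ≤
      ε * (((Metric.ball (0 : Fin n → ℝ) r ∩ Γ).ncard : ℝ) / M r) := by
    intro r
    have hΓfin : (Metric.ball (0 : Fin n → ℝ) r ∩ Γ).Finite :=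
      (finite_ball_inter_intPoints 0 r).subset (Set.inter_subset_inter_right _ hΓint)
    have hsum := sum_ncard_diffSet S hΓfin.toFinset hΓfin.coe_toFinset
    rw [← Finset.sum_div, ← Nat.cast_sum, hsum, Nat.cast_sum,
      Set.ncard_eq_toFinset_card _ hΓfin]
    have hdiff : (∑ y ∈ hΓfin.toFinset,
          ({v : Fin n → ℤ | v ∈ S ∧ y + intVec v ∈ Γ}.ncard : ℝ)) / M r / N
          - D * ((hΓfin.toFinset.card : ℝ) / M r) =
        (∑ y ∈ hΓfin.toFinset,
          (({v : Fin n → ℤ | v ∈ S ∧ y + intVec v ∈ Γ}.ncard : ℝ) / N - D)) / M r := by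
      rw [Finset.sum_sub_distrib, ← Finset.sum_div, Finset.sum_const, nsmul_eq_mul]
      ring
    have hM0 : 0 ≤ M r := Nat.cast_nonneg _
    rw [hdiff, abs_div, abs_of_nonneg hM0, ← mul_div_assoc]
    refine div_le_div_of_nonneg_right ?_ hM0
    calc _ ≤ ∑ y ∈ hΓfin.toFinset,
          |({v : Fin n → ℤ | v ∈ S ∧ y + intVec v ∈ Γ}.ncard : ℝ) / N - D| :=
          Finset.abs_sum_le_sum_abs _ _
      _ ≤ ∑ _y ∈ hΓfin.toFinset, ε :=
          Finset.sum_le_sum fun y hy => hcount y (hΓfin.mem_toFinset.1 hy).2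
      _ = ε * (hΓfin.toFinset.card : ℝ) := by
          rw [Finset.sum_const, nsmul_eq_mul, mul_comm]
  have hlim := le_of_tendsto_of_tendsto'
    ((((tendsto_finsetSum S fun v _ => (hρ v).tendsto 0).div_const N).sub
      ((hD.tendsto 0).const_mul D)).abs) ((hD.tendsto 0).const_mul ε) hbound
  have hfactor : (∑ v ∈ S, ρ v * D) / N - D * D = ((∑ v ∈ S, ρ v) / N - D) * D := by
    rw [← Finset.sum_mul]
    ring
  rw [hfactor, abs_mul, abs_of_pos hDpos] at hlim
  exact le_of_mul_le_mul_right hlim hDpos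

end
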